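/- Let n ≥ 1, let S be a symplectic 2n×2n real matrix, let W = ⊕_{i=1}^n ν_i I₂ with ν_i ∈ ℝ, and set σ = S W Sᵀ. Then for every integer k ≥ 1, tr[(Ω σ)^{2k−1} Ω] = (−1)^k · tr[S W^{2k−1} Sᵀ]. -/

import Mathlib

open Matrix BigOperators

/-- The standard symplectic form `Ω = ⨁ [[0,1],[-1,0]]`. -/
def Omega (n : ℕ) : Matrix (Fin (2*n)) (Fin (2*n)) ℝ :=
  Matrix.of fun i j =>
    if j.val = i.val + 1 ∧ i.val % 2 = 0 then (1:ℝ)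
    else if i.val = j.val + 1 ∧ j.val % 2 = 0 then -1 else 0

/-- The block-diagonal matrix `⨁_{i=1}^n ν_i I₂`. -/
noncomputable def pairDiag (n : ℕ) (ν : Fin n → ℝ) :
    Matrix (Fin (2*n)) (Fin (2*n)) ℝ :=
  Matrix.diagonal fun i => ν ⟨i.val / 2, by have := i.isLt; omega⟩

theorem Omega_mul_self (n : ℕ) : Omega n * Omega n = -1 := by
  ext i j
  obtain ⟨p, hp⟩ : ∃ p : Fin (2*n), p.val = if i.val % 2 = 0 then i.val + 1 else i.val - 1 := by
    refine ⟨⟨if i.val % 2 = 0 then i.val + 1 else i.val - 1, ?_⟩, rfl⟩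
    have := i.isLt
    split_ifs <;> omega
  rw [Matrix.mul_apply, Finset.sum_eq_single p]
  · simp only [Omega, Matrix.of_apply, Matrix.neg_apply, Matrix.one_apply, Fin.ext_iff]
    split_ifs at hp ⊢ <;> first | omega | norm_num
  · intro l _ hl
    have hl' : l.val ≠ p.val := fun h => hl (Fin.ext h)
    have h0 : Omega n i l = 0 := by
      simp only [Omega, Matrix.of_apply]
      split_ifs at hp ⊢ <;> first | omega | rfl
    rw [h0, zero_mul]
  · simp

theorem Omega_commute_pairDiag (n : ℕ) (ν : Fin n → ℝ) :
    Commute (Omega n) (pairDiag n ν) := by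
  ext i j
  rw [pairDiag, Matrix.mul_diagonal, Matrix.diagonal_mul]
  by_cases h : i.val / 2 = j.val / 2
  · simp only [h, mul_comm]
  · have h0 : Omega n i j = 0 := by
      simp only [Omega, Matrix.of_apply]
      split_ifs <;> first | omega | rfl
    simp [h0]

theorem transpose_mul_Omega_mul {n : ℕ} {S : Matrix (Fin (2*n)) (Fin (2*n)) ℝ}
    (hS : S * Omega n * Sᵀ = Omega n) : Sᵀ * Omega n * S = Omega n := by
  have h1 : S * (Omega n * Sᵀ * -Omega n) = 1 := by
    rw [← mul_assoc, ← mul_assoc, hS, mul_neg, Omega_mul_self, neg_neg]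
  have h2 := congrArg (Omega n * ·) (mul_eq_one_comm.mp h1)
  simpa [← mul_assoc, Omega_mul_self] using h2

theorem Omega_mul_pow_odd {n : ℕ} {S : Matrix (Fin (2*n)) (Fin (2*n)) ℝ}
    (hS : S * Omega n * Sᵀ = Omega n) (ν : Fin n → ℝ) (j : ℕ) :
    (Omega n * (S * pairDiag n ν * Sᵀ)) ^ (2*j+1)
      = (-1 : ℝ) ^ j • (Omega n * (S * pairDiag n ν ^ (2*j+1) * Sᵀ)) := by
  have hT := transpose_mul_Omega_mul hS
  have hc := (Omega_commute_pairDiag n ν).eq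
  have hΩ := Omega_mul_self n
  induction j with
  | zero => simp
  | succ j ih =>
    rw [show 2*(j+1)+1 = 2 + (2*j+1) by ring, pow_add, ih, pow_add (pairDiag n ν) 2]
    generalize pairDiag n ν ^ (2*j+1) = X
    generalize pairDiag n ν = W at hc ⊢
    generalize Omega n = J at hT hc hΩ ⊢
    have key : (J * (S * W * Sᵀ)) ^ 2 * (J * (S * X * Sᵀ))
        = -(J * (S * (W ^ 2 * X) * Sᵀ)) := by
      calc (J * (S * W * Sᵀ)) ^ 2 * (J * (S * X * Sᵀ))
          = J * S * W * (Sᵀ * J * S) * W * (Sᵀ * J * S) * X * Sᵀ := by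
            simp only [sq, mul_assoc]
        _ = J * S * W * (J * W) * J * X * Sᵀ := by rw [hT]; simp only [mul_assoc]
        _ = J * S * W * W * (J * J) * X * Sᵀ := by rw [hc]; simp only [mul_assoc]
        _ = -(J * (S * (W ^ 2 * X) * Sᵀ)) := by
            rw [hΩ]; simp only [sq, mul_assoc, mul_neg, neg_mul, one_mul]
    rw [Matrix.mul_smul, key, pow_succ (-1 : ℝ), mul_neg_one, smul_neg, neg_smul]

theorem statement8 (n : ℕ) (hn : 1 ≤ n)
    (S : Matrix (Fin (2*n)) (Fin (2*n)) ℝ)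
    (hS : S * Omega n * Sᵀ = Omega n)
    (ν : Fin n → ℝ) (k : ℕ) (hk : 1 ≤ k) :
    Matrix.trace ((Omega n * (S * pairDiag n ν * Sᵀ)) ^ (2*k-1) * Omega n)
      = (-1 : ℝ) ^ k * Matrix.trace (S * (pairDiag n ν) ^ (2*k-1) * Sᵀ) := by
  obtain ⟨j, rfl⟩ : ∃ j, k = j + 1 := ⟨k - 1, by omega⟩
  rw [show 2*(j+1)-1 = 2*j+1 by omega, Omega_mul_pow_odd hS, Matrix.smul_mul, Matrix.trace_smul,
    Matrix.trace_mul_comm, ← mul_assoc, Omega_mul_self, neg_one_mul, Matrix.trace_neg,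
    smul_eq_mul, pow_succ]
  ring
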